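/- Let G be a countable group, θ : G → G a group homomorphism, and u : ℤ → G with u_n = e for n ≥ 1, and let t be a Hausdorff topology on the Warne semigroup B_W for which the multiplication of B_W is jointly continuous, for which there is a t-continuous map inv : B_W → B_W with x·inv(x)·x = x and inv(x)·x·inv(x) = inv(x) for all x ∈ B_W, and such that (B_W,t) is a Baire space. Then t is the discrete topology. -/

import Mathlib

/-- The elements `f_{m,n}` of the Warne construction:
`f_{0,n} = e` and `f_{m,n} = θ^{m-1}(u_{n+1}) ⬝ θ^{m-2}(u_{n+2}) ⬝ … ⬝ u_{n+m}`. -/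
def warneF {G : Type*} [Group G] (θ : Monoid.End G) (u : ℤ → G) : ℕ → ℤ → G
  | 0, _ => 1
  | m + 1, n => (θ ^ m) (u (n + 1)) * warneF θ u m (n + 1)

/-- The multiplication of the Warne semigroup `B_W` on `ℤ × G × ℤ`:
`(a,g,b)·(c,h,d) = (a, g·f_{b−c,c}⁻¹·θ^{b−c}(h)·f_{b−c,d}, d−c+b)` if `b ≥ c`, and
`(a−b+c, f_{c−b,a}⁻¹·θ^{c−b}(g)·f_{c−b,b}·h, d)` if `b ≤ c`. -/
def warneMul {G : Type*} [Group G] (θ : Monoid.End G) (u : ℤ → G) :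
    ℤ × G × ℤ → ℤ × G × ℤ → ℤ × G × ℤ :=
  fun x y =>
    if y.1 ≤ x.2.2 then
      (x.1,
        x.2.1 * (warneF θ u (x.2.2 - y.1).toNat y.1)⁻¹ *
          (θ ^ (x.2.2 - y.1).toNat) y.2.1 * warneF θ u (x.2.2 - y.1).toNat y.2.2,
        y.2.2 - y.1 + x.2.2)
    else
      (x.1 - x.2.2 + y.1,
        (warneF θ u (y.1 - x.2.2).toNat x.1)⁻¹ *
          (θ ^ (y.1 - x.2.2).toNat) x.2.1 * warneF θ u (y.1 - x.2.2).toNat x.2.2 * y.2.1,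
        y.2.2)

/-- A nonempty countable T1 Baire space has an isolated point. -/
theorem exists_isOpen_singleton_of_countable_baire {X : Type*} [TopologicalSpace X] [T1Space X]
    [BaireSpace X] [Countable X] [Nonempty X] : ∃ x : X, IsOpen ({x} : Set X) := by
  obtain ⟨x, hx⟩ := nonempty_interior_of_iUnion_of_closed (f := fun x : X => ({x} : Set X))
    (fun _ => isClosed_singleton) (Set.iUnion_of_singleton X)
  refine ⟨x, ?_⟩
  rw [← (Set.subset_singleton_iff_eq.1 (interior_subset (s := {x}))).resolve_left hx.ne_empty]
  exact isOpen_interior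

section WarneMul

variable {G : Type*} [Group G] (θ : Monoid.End G) (u : ℤ → G)

theorem warneMul_of_eq (a b c : ℤ) (g h : G) :
    warneMul θ u (a, g, b) (b, h, c) = (a, g * h, c) := by
  simp [warneMul, warneF]

theorem warneMul_fst (x y : ℤ × G × ℤ) :
    (warneMul θ u x y).1 = max x.1 (x.1 - x.2.2 + y.1) := by
  unfold warneMul
  split_ifs <;> simp only <;> omega

theorem warneMul_snd_snd (x y : ℤ × G × ℤ) :
    (warneMul θ u x y).2.2 = max y.2.2 (y.2.2 - y.1 + x.2.2) := by
  unfold warneMul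
  split_ifs <;> simp only <;> omega

theorem warneMul_idempotent_of_le {m n : ℤ} (h : m ≤ n) :
    warneMul θ u (n, 1, n) (m, 1, m) = (n, 1, n) := by
  simp [warneMul, h]

/-- A generalized inverse `w` of `z` satisfies `z * w = (z.1, 1, z.1)`. -/
theorem warneMul_eq_idempotent {z w : ℤ × G × ℤ}
    (hz : warneMul θ u (warneMul θ u z w) z = z) (hw : warneMul θ u (warneMul θ u w z) w = w) :
    warneMul θ u z w = (z.1, 1, z.1) := by
  have h₁ := congrArg Prod.fst hz
  have h₂ := congrArg Prod.fst hw
  have h₃ := congrArg (fun x => x.2.2) hz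
  simp only [warneMul_fst, warneMul_snd_snd] at h₁ h₂ h₃
  obtain ⟨a, g, b⟩ := z
  obtain ⟨c, h, d⟩ := w
  obtain rfl : c = b := by simp only at *; omega
  obtain rfl : d = a := by simp only at *; omega
  simp only [warneMul_of_eq, Prod.mk.injEq, true_and, and_true] at hz ⊢
  simpa using hz

/-- The equation `p * z * q = x` determines `z` among the elements whose first coordinate is
at least that of a given solution, for suitable `p` and `q`. -/
theorem eq_of_warneMul_warneMul_eq {a b c d : ℤ} {g h : G} {z : ℤ × G × ℤ} (hc : c ≤ z.1)
    (hz : warneMul θ u (warneMul θ u (a, 1, c) z) (d, h⁻¹ * g, b) = (a, g, b)) :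
    z = (c, h, d) := by
  have h₁ := congrArg Prod.fst hz
  have h₃ := congrArg (fun x => x.2.2) hz
  simp only [warneMul_fst, warneMul_snd_snd] at h₁ h₃
  obtain ⟨c', h', d'⟩ := z
  obtain rfl : c' = c := by simp only at *; omega
  obtain rfl : d' = d := by simp only at *; omega
  simp only [warneMul_of_eq, one_mul, Prod.mk.injEq, true_and, and_true] at hz ⊢
  simpa [← mul_assoc, mul_inv_eq_one] using hz

end WarneMul

/-- A countable regular `I`-bisimple Hausdorff Baire topological inverse semigroup is
discrete: if `G` is countable and `t` is a Hausdorff Baire topology on the Warne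
semigroup `B_W` with jointly continuous multiplication and continuous inversion, then
`t` is the discrete topology. -/
theorem warne_countable_baire_discrete {G : Type*} [Group G] [Countable G]
    (θ : Monoid.End G) (u : ℤ → G)
    (hu : ∀ n : ℤ, 1 ≤ n → u n = 1)
    (t : TopologicalSpace (ℤ × G × ℤ)) (ht2 : @T2Space _ t)
    (hm : @Continuous _ _ (@instTopologicalSpaceProd _ _ t t) t
      (fun p : (ℤ × G × ℤ) × (ℤ × G × ℤ) => warneMul θ u p.1 p.2))
    (inv : ℤ × G × ℤ → ℤ × G × ℤ) (hinvc : @Continuous _ _ t t inv)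
    (hinv : ∀ x : ℤ × G × ℤ, warneMul θ u (warneMul θ u x (inv x)) x = x ∧
      warneMul θ u (warneMul θ u (inv x) x) (inv x) = inv x)
    (hbaire : @BaireSpace _ t) :
    t = ⊥ := by
  have hmul : Continuous fun p : (ℤ × G × ℤ) × (ℤ × G × ℤ) => warneMul θ u p.1 p.2 := hm
  have hcm {f g : ℤ × G × ℤ → ℤ × G × ℤ} (hf : Continuous f) (hg : Continuous g) :
      Continuous fun z => warneMul θ u (f z) (g z) := hmul.comp (hf.prodMk hg)
  have hidem (z : ℤ × G × ℤ) : warneMul θ u z (inv z) = (z.1, 1, z.1) :=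
    warneMul_eq_idempotent θ u (hinv z).1 (hinv z).2
  obtain ⟨⟨a, g, b⟩, hx⟩ := exists_isOpen_singleton_of_countable_baire (X := ℤ × G × ℤ)
  suffices hs : ∀ y : ℤ × G × ℤ, IsOpen ({y} : Set (ℤ × G × ℤ)) from
    (discreteTopology_iff_isOpen_singleton.2 hs).eq_bot
  rintro ⟨c, h, d⟩
  have hV : IsOpen {z | warneMul θ u (warneMul θ u (a, 1, c) z) (d, h⁻¹ * g, b) = (a, g, b)} :=
    hx.preimage (hcm (hcm continuous_const continuous_id) continuous_const)
  have hW : IsOpen {z | warneMul θ u (c - 1, 1, c - 1) (warneMul θ u z (inv z)) ≠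
      (c - 1, 1, c - 1)} :=
    isOpen_ne_fun (hcm continuous_const (hcm continuous_id hinvc)) continuous_const
  convert hV.inter hW using 1
  ext z
  constructor
  · rintro rfl
    refine ⟨by simp [warneMul_of_eq], fun heq => ?_⟩
    have := congrArg Prod.fst heq
    simp only [hidem, warneMul_fst] at this
    omega
  · rintro ⟨hz, hne⟩
    refine eq_of_warneMul_warneMul_eq θ u ?_ hz
    by_contra! hlt
    exact hne (by rw [hidem, warneMul_idempotent_of_le θ u (by omega)])
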